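/- For every q > 0 the function x ↦ u_q(x) h(x) is Lebesgue integrable on ℝ and ∫_ℝ u_q(x) h(x) dx = u_q(0)/q. -/

import Mathlib

open MeasureTheory Set Filter Real

/-- The q-resolvent density `u_q(x) = (1/π) ∫_0^∞ cos(xλ)/(q + λ^α) dλ`. -/
noncomputable def resolventDensity (α q x : ℝ) : ℝ :=
  (1 / π) * ∫ l in Ioi (0 : ℝ), Real.cos (x * l) / (q + l ^ α)

/-- The function `h(x) = (1/π) ∫_0^∞ (1 − cos(xλ))/λ^α dλ`. -/
noncomputable def hFun (α x : ℝ) : ℝ :=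
  (1 / π) * ∫ l in Ioi (0 : ℝ), (1 - Real.cos (x * l)) / l ^ α

/-- The function `l ↦ l ^ s / (q + l ^ α) ^ m`. -/
noncomputable def powQuot (α q s : ℝ) (m : ℕ) (l : ℝ) : ℝ := l ^ s / (q + l ^ α) ^ m

lemma hasDerivAt_powQuot {α q : ℝ} (hq : 0 < q) (s : ℝ) (m : ℕ) {l : ℝ} (hl : 0 < l) :
    HasDerivAt (powQuot α q s m)
      (s * powQuot α q (s - 1) m l - m * α * powQuot α q (s + α - 1) (m + 1) l) l := by
  have hD : 0 < q + l ^ α := by positivity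
  have h1 : HasDerivAt (fun l : ℝ => l ^ s) (s * l ^ (s - 1)) l :=
    Real.hasDerivAt_rpow_const (Or.inl hl.ne')
  have h2 : HasDerivAt (fun l : ℝ => q + l ^ α) (α * l ^ (α - 1)) l :=
    (Real.hasDerivAt_rpow_const (Or.inl hl.ne')).const_add q
  have h3 := h1.div (h2.pow m) (pow_ne_zero m hD.ne')
  refine h3.congr_deriv ?_
  have e : l ^ (s + α - 1) = l ^ s * l ^ (α - 1) := by
    rw [← Real.rpow_add hl]; ring_nf
  unfold powQuot
  rw [e]
  rcases m with _ | m
  · simp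
  · simp only [Nat.add_sub_cancel, Pi.pow_apply]
    field_simp
    ring

lemma measurable_powQuot (α q s : ℝ) (m : ℕ) : Measurable (powQuot α q s m) := by
  unfold powQuot; fun_prop

lemma powQuot_nonneg {α q : ℝ} (hq : 0 < q) (s : ℝ) (m : ℕ) {l : ℝ} (hl : 0 ≤ l) :
    0 ≤ powQuot α q s m l := by
  unfold powQuot; positivity

lemma integrableOn_powQuot {α q : ℝ} (hq : 0 < q) {s : ℝ} {m : ℕ} (hs : -1 < s)
    (hm : s - α * m < -1) : IntegrableOn (powQuot α q s m) (Ioi 0) := by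
  rw [← Ioc_union_Ioi_eq_Ioi zero_le_one]
  refine IntegrableOn.union ?_ ?_
  · have h : IntegrableOn (fun l : ℝ => l ^ s * (q ^ m)⁻¹) (Ioc 0 1) :=
      (((intervalIntegral.intervalIntegrable_rpow' hs).1).mul_const _)
    refine Integrable.mono' h (measurable_powQuot ..).aestronglyMeasurable ?_
    filter_upwards [ae_restrict_mem measurableSet_Ioc] with l hl
    have hl0 := hl.1
    rw [Real.norm_of_nonneg (powQuot_nonneg hq _ _ hl0.le), powQuot, div_eq_mul_inv]
    gcongr
    have := Real.rpow_pos_of_pos hl0 α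
    linarith
  · refine Integrable.mono' (integrableOn_Ioi_rpow_of_lt hm one_pos)
      (measurable_powQuot ..).aestronglyMeasurable ?_
    filter_upwards [ae_restrict_mem measurableSet_Ioi] with l hl
    have hl0 : 0 < l := lt_trans one_pos hl
    rw [Real.norm_of_nonneg (powQuot_nonneg hq _ _ hl0.le), powQuot, Real.rpow_sub hl0,
      Real.rpow_mul_natCast hl0.le]
    gcongr
    linarith

lemma tendsto_powQuot_zero {α q : ℝ} (hα : 0 < α) (hq : 0 < q) {s : ℝ} (hs : 0 ≤ s) (m : ℕ) :
    Tendsto (powQuot α q s m) (nhdsWithin 0 (Ioi 0)) (nhds (powQuot α q s m 0)) := by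
  have : ContinuousAt (powQuot α q s m) 0 := by
    unfold powQuot
    refine ContinuousAt.div (Real.continuousAt_rpow_const _ _ (Or.inr hs))
      ((continuousAt_const.add (Real.continuousAt_rpow_const _ _ (Or.inr hα.le))).pow m) ?_
    rw [Real.zero_rpow hα.ne', add_zero]
    positivity
  exact this.tendsto.mono_left nhdsWithin_le_nhds

lemma integrableOn_cos_mul {F : ℝ → ℝ} {s : Set ℝ} (x : ℝ) (hF : IntegrableOn F s) :
    IntegrableOn (fun l => Real.cos (x * l) * F l) s := by
  refine Integrable.bdd_mul (c := 1) hF (by fun_prop) (ae_of_all _ fun l => ?_)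
  simpa using Real.abs_cos_le_one (x * l)

lemma integrableOn_sin_mul {F : ℝ → ℝ} {s : Set ℝ} (x : ℝ) (hF : IntegrableOn F s) :
    IntegrableOn (fun l => Real.sin (x * l) * F l) s := by
  refine Integrable.bdd_mul (c := 1) hF (by fun_prop) (ae_of_all _ fun l => ?_)
  simpa using Real.abs_sin_le_one (x * l)

lemma integral_cos_mul_eq {F F' : ℝ → ℝ} {c : ℝ} (hF : ∀ l ∈ Ioi (0 : ℝ), HasDerivAt F (F' l) l)
    (hi : IntegrableOn F (Ioi 0)) (hi' : IntegrableOn F' (Ioi 0))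
    (h0 : Tendsto F (nhdsWithin 0 (Ioi 0)) (nhds c)) {x : ℝ} (hx : x ≠ 0) :
    ∫ l in Ioi (0 : ℝ), Real.cos (x * l) * F l
      = -(1 / x) * ∫ l in Ioi (0 : ℝ), Real.sin (x * l) * F' l := by
  have hinf := tendsto_zero_of_hasDerivAt_of_integrableOn_Ioi hF hi' hi
  have hv : ∀ l ∈ Ioi (0 : ℝ),
      HasDerivAt (fun l => Real.sin (x * l) / x) (Real.cos (x * l)) l := fun l _ => by
    have h := (((hasDerivAt_id l).const_mul x).sin).div_const x
    refine h.congr_deriv ?_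
    simp only [id]
    field_simp
  have key := integral_Ioi_mul_deriv_eq_deriv_mul (a := 0) (a' := c * 0) (b' := 0)
    (u := F) (u' := F') hF hv ?_ ?_ ?_ ?_
  · calc _ = ∫ l in Ioi (0 : ℝ), F l * Real.cos (x * l) := by simp_rw [mul_comm]
      _ = _ := key
      _ = _ := by
        rw [← integral_const_mul, mul_zero, sub_zero, zero_sub, ← integral_neg]
        congr 1; ext l; ring
  · exact (integrableOn_cos_mul x hi).congr_fun (fun l _ => mul_comm _ _) measurableSet_Ioi
  · refine ((integrableOn_sin_mul x hi').div_const x).congr (ae_of_all _ fun l => ?_)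
    simp only [Pi.mul_apply]; ring
  · refine h0.mul ?_
    have : ContinuousAt (fun l => Real.sin (x * l) / x) 0 := by fun_prop
    simpa [ContinuousAt] using this.tendsto.mono_left nhdsWithin_le_nhds
  · refine hinf.zero_mul_isBoundedUnder_le ⟨1 / |x|, ?_⟩
    simp only [eventually_map]
    refine Eventually.of_forall fun l => ?_
    simp only [Function.comp, norm_div, Real.norm_eq_abs]
    gcongr
    exact Real.abs_sin_le_one _

lemma integral_sin_mul_eq {F F' : ℝ → ℝ} (hF : ∀ l ∈ Ioi (0 : ℝ), HasDerivAt F (F' l) l)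
    (hi : IntegrableOn F (Ioi 0)) (hi' : IntegrableOn F' (Ioi 0))
    (h0 : Tendsto F (nhdsWithin 0 (Ioi 0)) (nhds 0)) {x : ℝ} (hx : x ≠ 0) :
    ∫ l in Ioi (0 : ℝ), Real.sin (x * l) * F l
      = (1 / x) * ∫ l in Ioi (0 : ℝ), Real.cos (x * l) * F' l := by
  have hinf := tendsto_zero_of_hasDerivAt_of_integrableOn_Ioi hF hi' hi
  have hv : ∀ l ∈ Ioi (0 : ℝ),
      HasDerivAt (fun l => -Real.cos (x * l) / x) (Real.sin (x * l)) l := fun l _ => by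
    have h := (((hasDerivAt_id l).const_mul x).cos).neg.div_const x
    refine h.congr_deriv ?_
    simp only [id]
    field_simp
  have hb : ∀ l, ‖-Real.cos (x * l) / x‖ ≤ 1 / |x| := fun l => by
    simp only [norm_div, norm_neg, Real.norm_eq_abs]
    gcongr
    exact Real.abs_cos_le_one _
  have key := integral_Ioi_mul_deriv_eq_deriv_mul (a := 0) (a' := 0) (b' := 0)
    (u := F) (u' := F') hF hv ?_ ?_ ?_ ?_
  · calc _ = ∫ l in Ioi (0 : ℝ), F l * Real.sin (x * l) := by simp_rw [mul_comm]
      _ = _ := key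
      _ = _ := by
        rw [← integral_const_mul, sub_zero, zero_sub, ← integral_neg]
        congr 1; ext l; ring
  · exact (integrableOn_sin_mul x hi).congr_fun (fun l _ => mul_comm _ _) measurableSet_Ioi
  · refine ((integrableOn_cos_mul x hi').div_const (-x)).congr (ae_of_all _ fun l => ?_)
    simp only [Pi.mul_apply]; ring
  · exact h0.zero_mul_isBoundedUnder_le ⟨1 / |x|, eventually_map.2 (Eventually.of_forall hb)⟩
  · exact hinf.zero_mul_isBoundedUnder_le ⟨1 / |x|, eventually_map.2 (Eventually.of_forall hb)⟩

lemma abs_integral_cos_mul_le {F : ℝ → ℝ} {s : Set ℝ} (hF : IntegrableOn F s) (x : ℝ) :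
    |∫ l in s, Real.cos (x * l) * F l| ≤ ∫ l in s, |F l| := by
  rw [← Real.norm_eq_abs]
  refine norm_integral_le_of_norm_le hF.abs (ae_of_all _ fun l => ?_)
  rw [norm_mul]
  exact mul_le_of_le_one_left (abs_nonneg _) (Real.abs_cos_le_one _)

lemma abs_integral_sin_mul_le {F : ℝ → ℝ} {s : Set ℝ} (hF : IntegrableOn F s) (x : ℝ) :
    |∫ l in s, Real.sin (x * l) * F l| ≤ ∫ l in s, |F l| := by
  rw [← Real.norm_eq_abs]
  refine norm_integral_le_of_norm_le hF.abs (ae_of_all _ fun l => ?_)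
  rw [norm_mul]
  exact mul_le_of_le_one_left (abs_nonneg _) (Real.abs_sin_le_one _)

lemma resolventDensity_eq_powQuot (α q x : ℝ) :
    resolventDensity α q x
      = (1 / π) * ∫ l in Ioi (0 : ℝ), Real.cos (x * l) * powQuot α q 0 1 l := by
  simp [resolventDensity, powQuot, div_eq_mul_inv]

lemma resolventDensity_eq_second {α q : ℝ} (hα : 1 < α) (hq : 0 < q) {x : ℝ} (hx : x ≠ 0) :
    resolventDensity α q x
      = -(1 / (π * x ^ 2)) * ∫ l in Ioi (0 : ℝ), Real.cos (x * l) *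
        (-α * (α - 1) * powQuot α q (α - 2) 2 l + 2 * α ^ 2 * powQuot α q (2 * α - 2) 3 l) := by
  have d1 : ∀ l ∈ Ioi (0 : ℝ),
      HasDerivAt (powQuot α q 0 1) (-α * powQuot α q (α - 1) 2 l) l := fun l hl =>
    (hasDerivAt_powQuot hq 0 1 hl).congr_deriv (by norm_num)
  have d2 : ∀ l ∈ Ioi (0 : ℝ), HasDerivAt (fun l => -α * powQuot α q (α - 1) 2 l)
      (-α * (α - 1) * powQuot α q (α - 2) 2 l + 2 * α ^ 2 * powQuot α q (2 * α - 2) 3 l) l :=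
    fun l hl => ((hasDerivAt_powQuot hq (α - 1) 2 hl).const_mul (-α)).congr_deriv (by
      rw [show α - 1 - 1 = α - 2 by ring, show α - 1 + α - 1 = 2 * α - 2 by ring]
      push_cast; ring)
  have i0 : IntegrableOn (powQuot α q 0 1) (Ioi 0) :=
    integrableOn_powQuot hq (by norm_num) (by norm_num; linarith)
  have i1 : IntegrableOn (fun l => -α * powQuot α q (α - 1) 2 l) (Ioi 0) :=
    (integrableOn_powQuot hq (by linarith) (by norm_num; linarith)).const_mul _
  have i2 : IntegrableOn (fun l => -α * (α - 1) * powQuot α q (α - 2) 2 l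
      + 2 * α ^ 2 * powQuot α q (2 * α - 2) 3 l) (Ioi 0) :=
    ((integrableOn_powQuot hq (by linarith) (by norm_num; linarith)).const_mul _).add
      ((integrableOn_powQuot hq (by linarith) (by norm_num; linarith)).const_mul _)
  have t1 : Tendsto (fun l => -α * powQuot α q (α - 1) 2 l) (nhdsWithin 0 (Ioi 0)) (nhds 0) := by
    have := (tendsto_powQuot_zero (by linarith : 0 < α) hq (by linarith : 0 ≤ α - 1) 2).const_mul
      (-α)
    simpa [powQuot, Real.zero_rpow (by linarith : α - 1 ≠ 0)] using this
  rw [resolventDensity_eq_powQuot,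
    integral_cos_mul_eq d1 i0 i1 (tendsto_powQuot_zero (by linarith) hq le_rfl 1) hx,
    integral_sin_mul_eq d2 i1 i2 t1 hx, ← mul_assoc, ← mul_assoc]
  congr 1
  field_simp

lemma resolventDensity_two_eq_third {q : ℝ} (hq : 0 < q) {x : ℝ} (hx : x ≠ 0) :
    resolventDensity 2 q x = (1 / (π * x ^ 3)) * ∫ l in Ioi (0 : ℝ), Real.sin (x * l) *
      (24 * powQuot 2 q 1 3 l - 48 * powQuot 2 q 3 4 l) := by
  have d : ∀ l ∈ Ioi (0 : ℝ),
      HasDerivAt (fun l => -2 * (2 - 1) * powQuot 2 q (2 - 2) 2 l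
        + 2 * 2 ^ 2 * powQuot 2 q (2 * 2 - 2) 3 l)
      (24 * powQuot 2 q 1 3 l - 48 * powQuot 2 q 3 4 l) l := fun l hl =>
    (((hasDerivAt_powQuot hq (2 - 2) 2 hl).const_mul (-2 * (2 - 1))).add
      ((hasDerivAt_powQuot hq (2 * 2 - 2) 3 hl).const_mul (2 * 2 ^ 2))).congr_deriv (by
        norm_num; ring)
  have t : Tendsto (fun l => -2 * (2 - 1) * powQuot 2 q (2 - 2) 2 l
        + 2 * 2 ^ 2 * powQuot 2 q (2 * 2 - 2) 3 l) (nhdsWithin 0 (Ioi 0)) (nhds _) :=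
    ((tendsto_powQuot_zero two_pos hq (by norm_num) 2).const_mul _).add
      ((tendsto_powQuot_zero two_pos hq (by norm_num) 3).const_mul _)
  rw [resolventDensity_eq_second one_lt_two hq hx, integral_cos_mul_eq d ?_ ?_ t hx]
  · field_simp
  · exact ((integrableOn_powQuot hq (by norm_num) (by norm_num)).const_mul _).add
      ((integrableOn_powQuot hq (by norm_num) (by norm_num)).const_mul _)
  · exact ((integrableOn_powQuot hq (by norm_num) (by norm_num)).const_mul _).sub
      ((integrableOn_powQuot hq (by norm_num) (by norm_num)).const_mul _)

/-- The resolvent density decays faster than `|x| ^ (-α)`. -/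
lemma exists_resolventDensity_decay {α q : ℝ} (hα1 : 1 < α) (hα2 : α ≤ 2) (hq : 0 < q) :
    ∃ p : ℕ, α < p ∧ ∃ C : ℝ, 0 ≤ C ∧ ∀ x : ℝ, x ≠ 0 → |resolventDensity α q x| ≤ C / |x| ^ p := by
  rcases hα2.lt_or_eq with h | rfl
  · refine ⟨2, by exact_mod_cast h, (1 / π) * ∫ l in Ioi (0 : ℝ),
      |-α * (α - 1) * powQuot α q (α - 2) 2 l + 2 * α ^ 2 * powQuot α q (2 * α - 2) 3 l|,
      by positivity, fun x hx => ?_⟩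
    have i2 : IntegrableOn (fun l => -α * (α - 1) * powQuot α q (α - 2) 2 l
        + 2 * α ^ 2 * powQuot α q (2 * α - 2) 3 l) (Ioi 0) :=
      ((integrableOn_powQuot hq (by linarith) (by norm_num; linarith)).const_mul _).add
        ((integrableOn_powQuot hq (by linarith) (by norm_num; linarith)).const_mul _)
    have hb := abs_integral_cos_mul_le i2 x
    rw [resolventDensity_eq_second hα1 hq hx, abs_mul, abs_neg, abs_div, abs_mul, abs_pow, abs_one,
      abs_of_pos Real.pi_pos]
    refine (mul_le_mul_of_nonneg_left hb (by positivity)).trans_eq ?_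
    rw [mul_div_right_comm, div_div]
  · refine ⟨3, by norm_num, (1 / π) * ∫ l in Ioi (0 : ℝ),
      |24 * powQuot 2 q 1 3 l - 48 * powQuot 2 q 3 4 l|, by positivity, fun x hx => ?_⟩
    have i3 : IntegrableOn (fun l => 24 * powQuot 2 q 1 3 l - 48 * powQuot 2 q 3 4 l) (Ioi 0) :=
      ((integrableOn_powQuot hq (by norm_num) (by norm_num)).const_mul _).sub
        ((integrableOn_powQuot hq (by norm_num) (by norm_num)).const_mul _)
    have hb := abs_integral_sin_mul_le i3 x
    rw [resolventDensity_two_eq_third hq hx, abs_mul, abs_div, abs_mul, abs_pow, abs_one,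
      abs_of_pos Real.pi_pos]
    refine (mul_le_mul_of_nonneg_left hb (by positivity)).trans_eq ?_
    rw [mul_div_right_comm, div_div]

lemma integrableOn_inv_add_rpow {α q : ℝ} (hα : 1 < α) (hq : 0 < q) :
    IntegrableOn (powQuot α q 0 1) (Ioi 0) :=
  integrableOn_powQuot hq (by norm_num) (by norm_num; linarith)

lemma continuous_resolventDensity {α q : ℝ} (hα : 1 < α) (hq : 0 < q) :
    Continuous (resolventDensity α q) := by
  simp only [funext (resolventDensity_eq_powQuot α q)]
  refine continuous_const.mul ?_
  refine continuous_of_dominated (bound := fun l => |powQuot α q 0 1 l|)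
    (fun x => (integrableOn_cos_mul x (integrableOn_inv_add_rpow hα hq)).aestronglyMeasurable)
    (fun x => ae_of_all _ fun l => ?_) (integrableOn_inv_add_rpow hα hq).abs
    (ae_of_all _ fun l => by fun_prop)
  rw [norm_mul]
  exact mul_le_of_le_one_left (abs_nonneg _) (Real.abs_cos_le_one _)

lemma exists_abs_resolventDensity_le {α q : ℝ} (hα : 1 < α) (hq : 0 < q) :
    ∃ C : ℝ, 0 ≤ C ∧ ∀ x : ℝ, |resolventDensity α q x| ≤ C := by
  refine ⟨(1 / π) * ∫ l in Ioi (0 : ℝ), |powQuot α q 0 1 l|, by positivity, fun x => ?_⟩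
  rw [resolventDensity_eq_powQuot, abs_mul, abs_of_pos (by positivity : 0 < 1 / π)]
  exact mul_le_mul_of_nonneg_left (abs_integral_cos_mul_le (integrableOn_inv_add_rpow hα hq) x)
    (by positivity)

lemma integrable_resolventDensity_mul_rpow {α q β : ℝ} (hα1 : 1 < α) (hα2 : α ≤ 2) (hq : 0 < q)
    (hβ : 0 ≤ β) (hβα : β ≤ α - 1) :
    Integrable (fun x : ℝ => resolventDensity α q x * |x| ^ β) := by
  obtain ⟨p, hp, C, hC, hCx⟩ := exists_resolventDensity_decay hα1 hα2 hq
  obtain ⟨B, hB, hBx⟩ := exists_abs_resolventDensity_le hα1 hq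
  have hint : Integrable (fun x : ℝ => (B + C) * ((1 + |x|) / 2) ^ (-(p - β))) := by
    have h := (integrable_one_add_norm (E := ℝ) (μ := volume) (r := p - β)
      (by simp; linarith)).div_const (2 ^ (-(p - β)))
    refine (h.const_mul (B + C)).congr (ae_of_all _ fun x => ?_)
    simp only [Real.norm_eq_abs]
    rw [Real.div_rpow (by positivity) (by norm_num)]
  refine hint.mono' ((continuous_resolventDensity hα1 hq).mul
    (continuous_abs.rpow_const fun _ => Or.inr hβ)).aestronglyMeasurable
    (ae_of_all _ fun x => ?_)
  rw [norm_mul, Real.norm_eq_abs, Real.norm_of_nonneg (by positivity)]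
  rcases le_total |x| 1 with hx | hx
  · calc |resolventDensity α q x| * |x| ^ β ≤ B * 1 := by
          gcongr
          · exact hBx x
          · exact Real.rpow_le_one (abs_nonneg _) hx hβ
      _ ≤ (B + C) * ((1 + |x|) / 2) ^ (-(p - β)) := by
          gcongr
          · linarith
          · exact Real.one_le_rpow_of_pos_of_le_one_of_nonpos (by positivity) (by linarith)
              (by linarith)
  · have hx0 : 0 < |x| := one_pos.trans_le hx
    calc |resolventDensity α q x| * |x| ^ β ≤ C / |x| ^ p * |x| ^ β := by
          gcongr
          exact hCx x (abs_pos.1 hx0)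
      _ = C * |x| ^ (-(p - β)) := by
          rw [neg_sub, Real.rpow_sub hx0, Real.rpow_natCast]; ring
      _ ≤ (B + C) * ((1 + |x|) / 2) ^ (-(p - β)) := by
          gcongr ?_ * ?_
          · linarith
          · exact Real.rpow_le_rpow_of_nonpos (by positivity) (by linarith) (by linarith)

lemma integrable_resolventDensity {α q : ℝ} (hα1 : 1 < α) (hα2 : α ≤ 2) (hq : 0 < q) :
    Integrable (resolventDensity α q) := by
  simpa using integrable_resolventDensity_mul_rpow hα1 hα2 hq le_rfl (by linarith)

lemma integrableOn_one_sub_cos_div {α : ℝ} (hα1 : 1 < α) (hα2 : α ≤ 2) (x : ℝ) :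
    IntegrableOn (fun l : ℝ => (1 - Real.cos (x * l)) / l ^ α) (Ioi 0) := by
  have hm : Measurable (fun l : ℝ => (1 - Real.cos (x * l)) / l ^ α) := by fun_prop
  have hn : ∀ l : ℝ, 0 < l → ‖(1 - Real.cos (x * l)) / l ^ α‖ = (1 - Real.cos (x * l)) / l ^ α :=
    fun l hl => Real.norm_of_nonneg
      (div_nonneg (by linarith [Real.cos_le_one (x * l)]) (by positivity))
  rw [← Ioc_union_Ioi_eq_Ioi zero_le_one]
  refine IntegrableOn.union ?_ ?_
  · refine Integrable.mono' (integrable_const (x ^ 2 / 2)) hm.aestronglyMeasurable ?_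
    filter_upwards [ae_restrict_mem measurableSet_Ioc] with l hl
    rw [hn l hl.1, div_le_iff₀ (Real.rpow_pos_of_pos hl.1 _)]
    have h1 : l ^ 2 ≤ l ^ α := by
      rw [← Real.rpow_two]
      exact Real.rpow_le_rpow_of_exponent_ge hl.1 hl.2 hα2
    have h2 := Real.one_sub_sq_div_two_le_cos (x := x * l)
    calc 1 - Real.cos (x * l) ≤ x ^ 2 / 2 * l ^ 2 := by linarith [mul_pow x l 2]
      _ ≤ _ := by gcongr
  · refine Integrable.mono' ((integrableOn_Ioi_rpow_of_lt (neg_lt_neg hα1) one_pos).const_mul 2)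
      hm.aestronglyMeasurable ?_
    filter_upwards [ae_restrict_mem measurableSet_Ioi] with l hl
    have hl0 : 0 < l := one_pos.trans hl
    rw [hn l hl0, Real.rpow_neg hl0.le, div_eq_mul_inv]
    gcongr
    linarith [Real.neg_one_le_cos (x * l)]

lemma hFun_eq_rpow {α : ℝ} (hα : 1 < α) (x : ℝ) : hFun α x = hFun α 1 * |x| ^ (α - 1) := by
  rcases eq_or_ne x 0 with rfl | hx
  · simp [hFun, Real.zero_rpow (by linarith : α - 1 ≠ 0)]
  have hx0 : 0 < |x| := abs_pos.2 hx
  have h := integral_comp_mul_left_Ioi (fun l : ℝ => (1 - Real.cos l) / l ^ α) 0 hx0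
  have h2 : ∫ l in Ioi (0 : ℝ), (1 - Real.cos (x * l)) / l ^ α
      = |x| ^ α * ∫ l in Ioi (0 : ℝ), (1 - Real.cos (|x| * l)) / (|x| * l) ^ α := by
    rw [← integral_const_mul]
    refine setIntegral_congr_fun measurableSet_Ioi fun l hl => ?_
    have hl0 : (0 : ℝ) < l := hl
    have hc : Real.cos (|x| * l) = Real.cos (x * l) := by
      rw [← Real.cos_abs (x * l), abs_mul, abs_of_pos hl0]
    have := Real.rpow_pos_of_pos hx0 α
    have := Real.rpow_pos_of_pos hl0 α
    rw [hc, Real.mul_rpow hx0.le hl0.le]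
    field_simp
  simp only [mul_zero] at h
  rw [hFun, hFun, h2, h, Real.rpow_sub hx0, Real.rpow_one]
  simp only [one_mul, smul_eq_mul]
  ring

lemma hFun_nonneg (α x : ℝ) : 0 ≤ hFun α x := by
  refine mul_nonneg (by positivity) (setIntegral_nonneg measurableSet_Ioi fun l hl => ?_)
  exact div_nonneg (by linarith [Real.cos_le_one (x * l)]) (Real.rpow_nonneg (le_of_lt hl) _)

lemma integral_exp_mul_of_even {g : ℝ → ℝ} (hg : Integrable g) (he : ∀ x, g (-x) = g x) (w : ℝ) :
    ∫ v : ℝ, Complex.exp ((w * v : ℝ) * Complex.I) • (g v : ℂ)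
      = ((∫ v : ℝ, Real.cos (w * v) * g v : ℝ) : ℂ) := by
  have hi : ∀ w : ℝ, Integrable fun v : ℝ => Complex.exp ((w * v : ℝ) * Complex.I) • (g v : ℂ) := by
    intro w
    refine Integrable.bdd_mul (c := 1) hg.ofReal (by fun_prop) (ae_of_all _ fun v => ?_)
    rw [Complex.norm_exp_ofReal_mul_I]
  have hneg : ∫ v : ℝ, Complex.exp ((w * v : ℝ) * Complex.I) • (g v : ℂ)
      = ∫ v : ℝ, Complex.exp ((-w * v : ℝ) * Complex.I) • (g v : ℂ) := by
    rw [← integral_neg_eq_self]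
    congr 1; ext v
    rw [he]; congr 4; ring
  have hsum : (2 : ℂ) * ∫ v : ℝ, Complex.exp ((w * v : ℝ) * Complex.I) • (g v : ℂ)
      = 2 * ((∫ v : ℝ, Real.cos (w * v) * g v : ℝ) : ℂ) := by
    rw [two_mul]
    conv_lhs => rw [add_comm]; enter [1]; rw [hneg]
    rw [← integral_add (hi _) (hi _), ← integral_complex_ofReal, ← integral_const_mul]
    congr 1; ext v
    simp only [smul_eq_mul, ← add_mul]
    rw [Complex.ofReal_mul (Real.cos _), Complex.ofReal_cos, ← mul_assoc, Complex.two_cos]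
    push_cast
    ring_nf
  exact mul_left_cancel₀ two_ne_zero hsum

lemma integrable_inv_add_abs_rpow {α q : ℝ} (hα : 1 < α) (hq : 0 < q) :
    Integrable (fun v : ℝ => (q + |v| ^ α)⁻¹) := by
  have h : IntegrableOn (fun v : ℝ => (q + |v| ^ α)⁻¹) (Ioi 0) :=
    (integrableOn_inv_add_rpow hα hq).congr_fun (fun l hl => by
      simp [powQuot, abs_of_pos (mem_Ioi.1 hl)]) measurableSet_Ioi
  have hneg : IntegrableOn (fun v : ℝ => (q + |v| ^ α)⁻¹) (Iio 0) := by
    rw [← (Measure.measurePreserving_neg (volume : Measure ℝ)).integrableOn_comp_preimage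
      (MeasurableEquiv.neg ℝ).measurableEmbedding]
    simpa [Function.comp_def] using h
  rw [← integrableOn_univ, ← Iic_union_Ioi (a := (0 : ℝ))]
  exact ((integrableOn_Iic_iff_integrableOn_Iio (by simp)).2 hneg).union h

open FourierTransform in
lemma integral_cos_mul_resolventDensity {α q : ℝ} (hα1 : 1 < α) (hα2 : α ≤ 2) (hq : 0 < q)
    (l : ℝ) : ∫ x : ℝ, Real.cos (l * x) * resolventDensity α q x = (q + |l| ^ α)⁻¹ := by
  set f : ℝ → ℝ := fun v => (q + |v| ^ α)⁻¹ with hf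
  have hpos : ∀ v : ℝ, 0 < q + |v| ^ α := fun v => by positivity
  have hfi : Integrable f := integrable_inv_add_abs_rpow hα1 hq
  have hfc : Continuous f := Continuous.inv₀ (continuous_const.add
    (continuous_abs.rpow_const fun _ => Or.inr (by linarith))) fun v => (hpos v).ne'
  have hcos : ∀ x : ℝ, ∫ v : ℝ, Real.cos (x * v) * f v = 2 * π * resolventDensity α q x := by
    intro x
    have h := integral_comp_abs (f := fun v => Real.cos (x * v) / (q + v ^ α))
    rw [resolventDensity, ← mul_assoc, mul_one_div, mul_div_cancel_right₀ _ Real.pi_ne_zero, ← h]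
    congr 1; ext v
    have : Real.cos (x * |v|) = Real.cos (x * v) := by
      rw [← Real.cos_abs (x * v), ← Real.cos_abs (x * |v|), abs_mul, abs_mul, abs_abs]
    rw [this, div_eq_mul_inv]
  have heven : ∀ x, resolventDensity α q (-x) = resolventDensity α q x := fun x => by
    simp [resolventDensity]
  have hF : 𝓕 (fun v => (f v : ℂ))
      = fun w => ((2 * π * resolventDensity α q (2 * π * w) : ℝ) : ℂ) := by
    ext w
    rw [Real.fourier_real_eq_integral_exp_smul]
    have h := integral_exp_mul_of_even hfi (fun v => by simp [hf]) (-(2 * π * w))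
    rw [hcos, heven] at h
    rw [← h]
    congr 1; ext v; congr 4; ring
  have hui : Integrable fun w => 2 * π * resolventDensity α q (2 * π * w) :=
    ((integrable_resolventDensity hα1 hα2 hq).comp_mul_left' (by positivity)).const_mul _
  have hinv := congrFun (Continuous.fourierInv_fourier_eq (f := fun v => (f v : ℂ))
    (by fun_prop) hfi.ofReal (by rw [hF]; exact hui.ofReal)) l
  rw [hF, Real.fourierInv_eq'] at hinv
  have h2 := integral_exp_mul_of_even hui (fun w => by rw [mul_neg, heven]) (2 * π * l)
  have h3 : ∫ w : ℝ, Real.cos (2 * π * l * w) * (2 * π * resolventDensity α q (2 * π * w)) = f l := by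
    apply Complex.ofReal_injective
    rw [← h2, ← hinv]
    congr 1; ext w; congr 4
    simp only [RCLike.inner_apply, conj_trivial]
    ring
  have h4 := Measure.integral_comp_mul_left
    (fun x => Real.cos (l * x) * (2 * π * resolventDensity α q x)) (2 * π)
  rw [← show f l = (q + |l| ^ α)⁻¹ from rfl, ← h3]
  have h5 : ∫ x : ℝ, Real.cos (l * x) * (2 * π * resolventDensity α q x)
      = 2 * π * ∫ x : ℝ, Real.cos (l * x) * resolventDensity α q x := by
    rw [← integral_const_mul]; congr 1; ext x; ring
  rw [h5, abs_of_pos (by positivity), smul_eq_mul,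
    inv_mul_cancel_left₀ (by positivity)] at h4
  rw [← h4]
  congr 1; ext w; congr 2; ring

/-- For every `q > 0` the function `x ↦ u_q(x) h(x)` is Lebesgue integrable on `ℝ`
and `∫_ℝ u_q(x) h(x) dx = u_q(0)/q`. -/
theorem resolvent_h_integral (α : ℝ) (hα1 : 1 < α) (hα2 : α ≤ 2)
    (q : ℝ) (hq : 0 < q) :
    Integrable (fun x : ℝ => resolventDensity α q x * hFun α x) ∧
    ∫ x : ℝ, resolventDensity α q x * hFun α x = resolventDensity α q 0 / q := by
  have hint : Integrable (fun x : ℝ => resolventDensity α q x * hFun α x) := by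
    refine ((integrable_resolventDensity_mul_rpow hα1 hα2 hq (by linarith : 0 ≤ α - 1)
      le_rfl).mul_const (hFun α 1)).congr (ae_of_all _ fun x => ?_)
    simp only
    rw [hFun_eq_rpow hα1 x]; ring
  refine ⟨hint, ?_⟩
  have hu := integrable_resolventDensity hα1 hα2 hq
  have hpi : ∀ x, ∫ l in Ioi (0 : ℝ), (1 - Real.cos (x * l)) / l ^ α = π * hFun α x := fun x => by
    rw [hFun, ← mul_assoc, mul_one_div_cancel Real.pi_ne_zero, one_mul]
  have hprod : Integrable (Function.uncurry fun x l : ℝ =>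
      resolventDensity α q x * ((1 - Real.cos (x * l)) / l ^ α))
      (volume.prod (volume.restrict (Ioi 0))) := by
    have hm := (continuous_resolventDensity hα1 hq).measurable
    rw [integrable_prod_iff (by unfold Function.uncurry; fun_prop)]
    refine ⟨ae_of_all _ fun x => ?_, ?_⟩
    · exact (integrableOn_one_sub_cos_div hα1 hα2 x).const_mul (resolventDensity α q x)
    refine (hint.norm.const_mul π).congr (ae_of_all _ fun x => ?_)
    simp only [Function.uncurry, norm_mul, Real.norm_of_nonneg (hFun_nonneg α x)]
    rw [integral_const_mul, mul_left_comm, ← hpi]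
    congr 1
    refine setIntegral_congr_fun measurableSet_Ioi fun l hl => ?_
    exact (Real.norm_of_nonneg (div_nonneg (by linarith [Real.cos_le_one (x * l)])
      (Real.rpow_nonneg (le_of_lt hl) _))).symm
  have hinner : ∀ l ∈ Ioi (0 : ℝ),
      ∫ x : ℝ, resolventDensity α q x * ((1 - Real.cos (x * l)) / l ^ α)
        = q⁻¹ * (Real.cos (0 * l) / (q + l ^ α)) := by
    intro l hl
    have hl0 : (0 : ℝ) < l := hl
    have h0 := integral_cos_mul_resolventDensity hα1 hα2 hq 0
    have h1 := integral_cos_mul_resolventDensity hα1 hα2 hq l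
    rw [abs_zero, Real.zero_rpow (by linarith), add_zero] at h0
    simp only [zero_mul, Real.cos_zero, one_mul] at h0
    rw [abs_of_pos hl0] at h1
    have hlα := Real.rpow_pos_of_pos hl0 α
    have hc : Integrable fun x : ℝ => Real.cos (l * x) * resolventDensity α q x :=
      integrableOn_univ.1 (integrableOn_cos_mul l hu.integrableOn)
    calc _ = ∫ x : ℝ, (resolventDensity α q x - Real.cos (l * x) * resolventDensity α q x) / l ^ α := by
          congr 1; ext x; rw [mul_comm x l]; ring
      _ = (q⁻¹ - (q + l ^ α)⁻¹) / l ^ α := by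
          rw [integral_div, integral_sub hu hc, h0, h1]
      _ = _ := by
          rw [zero_mul, Real.cos_zero]
          field_simp
          ring
  have hswap := integral_integral_swap hprod
  simp only [integral_const_mul, hpi] at hswap
  rw [setIntegral_congr_fun measurableSet_Ioi hinner, integral_const_mul] at hswap
  have hcomm : ∫ x : ℝ, resolventDensity α q x * (π * hFun α x)
      = π * ∫ x : ℝ, resolventDensity α q x * hFun α x := by
    rw [← integral_const_mul]; congr 1; ext x; ring
  rw [hcomm] at hswap
  rw [← mul_right_inj' Real.pi_ne_zero, hswap]
  simp only [resolventDensity]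
  field_simp
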